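/- (Soundness and completeness of SIG for the ETL semantics) For every LDEL formula φ: ⊢_SIG φ if and only if φ holds at every world of every normal epistemic temporal model with respect to U under the ETL semantics ⊩. -/

import Mathlib

namespace GameRuns

/-- An observation model: an equivalence relation on actions for each player. -/
structure ObsModel (I A : Type) where
  rel : I → A → A → Prop
  equiv : ∀ i, Equivalence (rel i)

/-- The data of a game structure: a partial transition function and game information. -/
structure GameData (I A P S : Type) where
  R : S → A → Option S
  O : S → I → Set P

/-- `G` is a game structure w.r.t. the player assignment `pl` and the
distinguished information pieces `pa`. -/
def IsGameStructure {I A P S : Type} (pl : A → I) (pa : A → P) (G : GameData I A P S) : Prop :=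
  Nonempty S ∧
  (∀ s a b, (G.R s a).isSome → (G.R s b).isSome → pl a = pl b) ∧
  (∀ s a, pa a ∈ G.O s (pl a) ↔ (G.R s a).isSome)

/-- The data of an epistemic model w.r.t. a game structure over states `S`. -/
structure EpiData (I A P S : Type) (W : Type) where
  f : W → S
  sim : I → W → W → Prop
  V : W → I → Set P

/-- `M` is an epistemic model w.r.t. the game structure `G`. -/
def IsEpiModel {I A P S W : Type} (G : GameData I A P S) (M : EpiData I A P S W) : Prop :=
  Nonempty W ∧
  (∀ i, Equivalence (M.sim i)) ∧
  (∀ i w v, M.sim i w v → G.O (M.f w) i = G.O (M.f v) i) ∧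
  (∀ w i, M.V w i = G.O (M.f w) i)

variable {I A P S : Type}

/-- Carrier of the update product `M ⊗ U`. -/
abbrev UpdW (G : GameData I A P S) {W : Type} (M : EpiData I A P S W) : Type :=
  {x : W × A // (G.R (M.f x.1) x.2).isSome}

/-- The update product `M ⊗ U`. -/
def update (G : GameData I A P S) (U : ObsModel I A) {W : Type} (M : EpiData I A P S W) :
    EpiData I A P S (UpdW G M) where
  f x := (G.R (M.f x.val.1) x.val.2).get x.prop
  sim i x y := M.sim i x.val.1 y.val.1 ∧ U.rel i x.val.2 y.val.2 ∧
    G.O ((G.R (M.f x.val.1) x.val.2).get x.prop) i =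
      G.O ((G.R (M.f y.val.1) y.val.2).get y.prop) i
  V x i := G.O ((G.R (M.f x.val.1) x.val.2).get x.prop) i

/-- The data of an epistemic temporal model. -/
structure ETLData (I A P : Type) (W : Type) where
  sim : I → W → W → Prop
  trans : A → W → W → Prop
  V : W → I → Set P

/-- `N` is an epistemic temporal model: nonempty carrier, equivalence relations. -/
def IsETL {W : Type} (N : ETLData I A P W) : Prop :=
  Nonempty W ∧ ∀ i, Equivalence (N.sim i)

/-- The set of actions available at a state of an epistemic temporal model. -/
def Act {W : Type} (N : ETLData I A P W) (s : W) : Set A := {a | ∃ t, N.trans a s t}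

/-- Normality of an epistemic temporal model w.r.t. an observation model:
no miracles, perfect recall, determinism, exclusive turns, info and knowledge of
own information. -/
def Normal (pl : A → I) (pa : A → P) (U : ObsModel I A) {W : Type}
    (N : ETLData I A P W) : Prop :=
  (∀ i a b s s' t t', N.sim i s s' → N.trans a s' t' → N.trans b s t →
      U.rel i b a → N.V t i = N.V t' i → N.sim i t t') ∧
  (∀ i a s t t', N.trans a s t → N.sim i t t' →
      ∃ s' b, N.sim i s s' ∧ U.rel i a b ∧ N.trans b s' t') ∧
  (∀ a s t t', N.trans a s t → N.trans a s t' → t = t') ∧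
  (∀ s : W, (Act N s).Nonempty → ∃ j, ∀ a ∈ Act N s, pl a = j) ∧
  (∀ s a, pa a ∈ N.V s (pl a) ↔ ∃ t, N.trans a s t) ∧
  (∀ i w v, N.sim i w v → N.V w i = N.V v i)

/-- A bundled epistemic model (carrier together with the model). -/
structure BEpi (I A P S : Type) where
  W : Type
  M : EpiData I A P S W

/-- Bundled update. -/
def bUpdate (G : GameData I A P S) (U : ObsModel I A) (B : BEpi I A P S) : BEpi I A P S :=
  ⟨UpdW G B.M, update G U B.M⟩

/-- Iterated update `M ⊗ U^k`. -/
def iter (G : GameData I A P S) (U : ObsModel I A) (B : BEpi I A P S) : ℕ → BEpi I A P S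
  | 0 => B
  | k + 1 => bUpdate G U (iter G U B k)

/-- Carrier of the run model generated by repeatedly updating `U`:
states of level `k` are the states of `M ⊗ U^k`. -/
abbrev RunW (G : GameData I A P S) (U : ObsModel I A) (B : BEpi I A P S) : Type :=
  Σ k : ℕ, (iter G U B k).W

/-- The successor state `(w, a)` of `w` in the next level of the run model. -/
def stepUp (G : GameData I A P S) (U : ObsModel I A) (B : BEpi I A P S) (k : ℕ)
    (w : (iter G U B k).W) (a : A) (h : (G.R ((iter G U B k).M.f w) a).isSome) :
    (iter G U B (k + 1)).W :=
  ⟨(w, a), h⟩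

/-- Epistemic relation of the run model. -/
def runSim (G : GameData I A P S) (U : ObsModel I A) (B : BEpi I A P S) (i : I) :
    RunW G U B → RunW G U B → Prop := fun x y =>
  ∃ h : x.1 = y.1,
    (iter G U B y.1).M.sim i (cast (congrArg (fun k => (iter G U B k).W) h) x.2) y.2

/-- Action relation of the run model. -/
def runTrans (G : GameData I A P S) (U : ObsModel I A) (B : BEpi I A P S) (a : A) :
    RunW G U B → RunW G U B → Prop := fun x y =>
  ∃ h : (G.R ((iter G U B x.1).M.f x.2) a).isSome,
    y = ⟨x.1 + 1, stepUp G U B x.1 x.2 a h⟩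

/-- The run model `F⊗(M)` generated by repeatedly updating `U`. -/
def runModel (G : GameData I A P S) (U : ObsModel I A) (B : BEpi I A P S) :
    ETLData I A P (RunW G U B) where
  sim := runSim G U B
  trans := runTrans G U B
  V x i := (iter G U B x.1).M.V x.2 i

/-- The induced state assignment function of the run model. -/
def runF (G : GameData I A P S) (U : ObsModel I A) (B : BEpi I A P S) :
    RunW G U B → S := fun x => (iter G U B x.1).M.f x.2



section More
variable {I A P S : Type}

/-- The state reached by following a list of actions from `s`, if it exists. -/
def runPath (G : GameData I A P S) : S → List A → Option S
  | s, [] => some s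
  | s, a :: l => (G.R s a).bind fun t => runPath G t l

theorem runPath_append (G : GameData I A P S) (s : S) (l : List A) (a : A) :
    runPath G s (l ++ [a]) = (runPath G s l).bind fun t => G.R t a := by
  induction l generalizing s with
  | nil => simp [runPath]
  | cons b l ih =>
    simp only [List.cons_append, runPath]
    cases h : G.R s b with
    | none => simp
    | some t => simp [ih]

/-- The initial world and the sequence of actions of a state of the run model. -/
def runActs (G : GameData I A P S) (U : ObsModel I A) (B : BEpi I A P S) :
    (k : ℕ) → (iter G U B k).W → B.W × List A
  | 0, w => (w, [])
  | k + 1, w =>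
      ((runActs G U B k w.val.1).1, (runActs G U B k w.val.1).2 ++ [w.val.2])

theorem runActs_path (G : GameData I A P S) (U : ObsModel I A) (B : BEpi I A P S) :
    ∀ (k : ℕ) (w : (iter G U B k).W),
      runPath G (B.M.f (runActs G U B k w).1) (runActs G U B k w).2 =
        some ((iter G U B k).M.f w) := by
  intro k
  induction k with
  | zero => intro w; rfl
  | succ k ih =>
    intro w
    have h1 := ih w.val.1
    show runPath G _ _ = some ((update G U (iter G U B k).M).f w)
    rw [show runActs G U B (k + 1) w =
        ((runActs G U B k w.val.1).1, (runActs G U B k w.val.1).2 ++ [w.val.2]) from rfl]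
    rw [runPath_append, h1]
    exact (Option.some_get w.prop).symm

/-- Carrier of the epistemic game tree generatedfrom `s`: valid histories. -/
abbrev TreeW (G : GameData I A P S) (s : S) : Type := {l : List A // (runPath G s l).isSome}

/-- The epistemic game tree generated from `s` with perfect recall,
viewed as an epistemic temporal model. -/
def tree (G : GameData I A P S) (s : S) : ETLData I A P (TreeW G s) where
  sim i w u := w.val.length = u.val.length ∧
    ∀ k, (runPath G s (w.val.take k)).map (fun t => G.O t i) =
      (runPath G s (u.val.take k)).map (fun t => G.O t i)
  trans a w u := u.val = w.val ++ [a]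
  V w i := G.O ((runPath G s w.val).get w.prop) i

/-- The tracking function from the run model of a certainty epistemic model to the
epistemic game tree generated from the (common-knowledge) initial state. -/
def tracking (G : GameData I A P S) (U : ObsModel I A) {W : Type} (M : EpiData I A P S W)
    (v : W) (hv : ∀ x : W, x = v) (x : RunW G U ⟨W, M⟩) : TreeW G (M.f v) :=
  ⟨(runActs G U ⟨W, M⟩ x.1 x.2).2, by
    have h : runPath G (M.f (runActs G U ⟨W, M⟩ x.1 x.2).1)
        (runActs G U ⟨W, M⟩ x.1 x.2).2 = some ((iter G U ⟨W, M⟩ x.1).M.f x.2) :=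
      runActs_path G U ⟨W, M⟩ x.1 x.2
    rw [hv (runActs G U ⟨W, M⟩ x.1 x.2).1] at h
    rw [h]
    rfl⟩

/-- `U` is non-informative w.r.t. an epistemic temporal model. -/
def NonInformative (U : ObsModel I A) {W : Type} (N : ETLData I A P W) : Prop :=
  ∀ i a b w u s t, N.trans a w s → N.trans b u t → N.sim i w u →
    ¬ U.rel i a b → N.V s i ≠ N.V t i

/-- Isomorphism of epistemic temporal models. -/
def IsIso {W W' : Type} (N : ETLData I A P W) (N' : ETLData I A P W') (g : W → W') : Prop :=
  Function.Bijective g ∧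
  (∀ i x y, N.sim i x y ↔ N'.sim i (g x) (g y)) ∧
  (∀ a x y, N.trans a x y ↔ N'.trans a (g x) (g y)) ∧
  (∀ x i, N.V x i = N'.V (g x) i)

/-- p-morphisms between epistemic temporal models. -/
def IsPMorphism {W W' : Type} (N : ETLData I A P W) (N' : ETLData I A P W')
    (g : W → W') : Prop :=
  (∀ w i, N.V w i = N'.V (g w) i) ∧
  (∀ i w u, N.sim i w u → N'.sim i (g w) (g u)) ∧
  (∀ i w s, N'.sim i (g w) s → ∃ v, g v = s ∧ N.sim i w v) ∧
  (∀ a w u, N.trans a w u → N'.trans a (g w) (g u)) ∧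
  (∀ a w s, N'.trans a (g w) s → ∃ v, g v = s ∧ N.trans a w v)

/-- The induced epistemic game structure `E(G)`, viewed as an epistemic temporal model. -/
def egame (G : GameData I A P S) : ETLData I A P S where
  sim i s t := G.O s i = G.O t i
  trans a s t := G.R s a = some t
  V s i := G.O s i

/-- `G` is a perfect information game: the induced epistemic relations are the identity. -/
def PerfectInfo (G : GameData I A P S) : Prop :=
  ∀ i s t, G.O s i = G.O t i → s = t

/-- The game induced by an epistemic temporal model: `R(s,a) = t` iff `s →_a t`. -/
noncomputable def inducedGame {W : Type} (N : ETLData I A P W) : GameData I A P W where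
  R s a := @dite _ (∃ t, N.trans a s t) (Classical.propDecidable _)
    (fun h => some h.choose) (fun _ => none)
  O := N.V

/-- The epistemic part induced by an epistemic temporal model. -/
def epiPart {W : Type} (N : ETLData I A P W) : EpiData I A P W W where
  f := id
  sim := N.sim
  V := N.V

theorem inducedGame_isSome {W : Type} (N : ETLData I A P W) {a : A} {s t : W}
    (h : N.trans a s t) : ((inducedGame N).R s a).isSome := by
  show (@dite _ (∃ t, N.trans a s t) (Classical.propDecidable _)
    (fun h => some h.choose) (fun _ => none)).isSome
  rw [dif_pos ⟨t, h⟩]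
  rfl

end More
section Lang
variable {I A P S : Type}

/-- The dynamic epistemic language LDEL. -/
inductive LDEL (I A P : Type) : Type where
  | top : LDEL I A P
  | atom : P → I → LDEL I A P
  | neg : LDEL I A P → LDEL I A P
  | conj : LDEL I A P → LDEL I A P → LDEL I A P
  | know : I → LDEL I A P → LDEL I A P
  | box : A → LDEL I A P → LDEL I A P

/-- Implication, defined from negation and conjunction. -/
def impF (φ ψ : LDEL I A P) : LDEL I A P := .neg (.conj φ (.neg ψ))

/-- Disjunction. -/
def orF (φ ψ : LDEL I A P) : LDEL I A P := .neg (.conj (.neg φ) (.neg ψ))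

/-- Biconditional. -/
def iffF (φ ψ : LDEL I A P) : LDEL I A P := .conj (impF φ ψ) (impF ψ φ)

/-- Diamond `⟨a⟩φ`. -/
def diaF (a : A) (φ : LDEL I A P) : LDEL I A P := .neg (.box a (.neg φ))

/-- The dual knowledge modality `K̂_i φ`. -/
def khatF (i : I) (φ : LDEL I A P) : LDEL I A P := .neg (.know i (.neg φ))

/-- Finite conjunction. -/
def bigAnd : List (LDEL I A P) → LDEL I A P
  | [] => .top
  | φ :: l => .conj φ (bigAnd l)

/-- Finite disjunction. -/
def bigOr : List (LDEL I A P) → LDEL I A P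
  | [] => .neg .top
  | φ :: l => orF φ (bigOr l)

/-- The characteristic formula `φ^o_i` of a combination of information pieces,
where `L1` enumerates the pieces in `B` and `L2` those not in `B`. -/
def charF (i : I) (L1 L2 : List P) : LDEL I A P :=
  .conj (bigAnd (L1.map (fun p => LDEL.atom p i)))
    (bigAnd (L2.map (fun p => LDEL.neg (LDEL.atom p i))))

/-- `TURN_i`, given an enumeration `l` of the actions of player `i`. -/
def turnF (l : List A) : LDEL I A P := bigOr (l.map (fun a => diaF a LDEL.top))

/-- Propositional evaluation treating atoms, `K_i ψ` and `[a]ψ` as atomic. -/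
def propEval (v : LDEL I A P → Prop) : LDEL I A P → Prop
  | .top => True
  | .neg φ => ¬ propEval v φ
  | .conj φ ψ => propEval v φ ∧ propEval v ψ
  | φ => v φ

/-- The dynamic (DEL-style) semantics `⊨` over epistemic models w.r.t. a game structure. -/
def dynSat (G : GameData I A P S) (U : ObsModel I A) :
    LDEL I A P → (W : Type) → EpiData I A P S W → W → Prop
  | .top, _, _, _ => True
  | .atom p i, _, M, w => p ∈ M.V w i
  | .neg φ, W, M, w => ¬ dynSat G U φ W M w
  | .conj φ ψ, W, M, w => dynSat G U φ W M w ∧ dynSat G U ψ W M w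
  | .know i φ, W, M, w => ∀ v, M.sim i w v → dynSat G U φ W M v
  | .box a φ, _, M, w => ∀ h : (G.R (M.f w) a).isSome,
      dynSat G U φ (UpdW G M) (update G U M) ⟨(w, a), h⟩

/-- The epistemic temporal (ETL-style) semantics `⊩`. -/
def etlSat {W : Type} (N : ETLData I A P W) : LDEL I A P → W → Prop
  | .top, _ => True
  | .atom p i, w => p ∈ N.V w i
  | .neg φ, w => ¬ etlSat N φ w
  | .conj φ ψ, w => etlSat N φ w ∧ etlSat N ψ w
  | .know i φ, w => ∀ v, N.sim i w v → etlSat N φ v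
  | .box a φ, w => ∀ v, N.trans a w v → etlSat N φ v

/-- `Z` is a `G`-bisimulation between two epistemic models w.r.t. `G`. -/
def IsGBisim {W W' : Type} (G : GameData I A P S) (M : EpiData I A P S W)
    (N : EpiData I A P S W') (Z : W → W' → Prop) : Prop :=
  ∀ w u, Z w u →
    M.f w = N.f u ∧
    (∀ i w', M.sim i w w' → ∃ u', N.sim i u u' ∧ Z w' u') ∧
    (∀ i u', N.sim i u u' → ∃ w', M.sim i w w' ∧ Z w' u')

/-- Pointed `G`-bisimilarity. -/
def GBisimilar {W W' : Type} (G : GameData I A P S) (M : EpiData I A P S W)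
    (N : EpiData I A P S W') (w : W) (u : W') : Prop :=
  ∃ Z, IsGBisim G M N Z ∧ Z w u

/-- The proof system SIG. -/
inductive SIG (pl : A → I) (pa : A → P) (U : ObsModel I A) : LDEL I A P → Prop where
  | taut {φ : LDEL I A P} : (∀ v, propEval v φ) → SIG pl pa U φ
  | distK (i : I) (φ ψ : LDEL I A P) :
      SIG pl pa U (impF (.know i (impF φ ψ)) (impF (.know i φ) (.know i ψ)))
  | distB (a : A) (φ ψ : LDEL I A P) :
      SIG pl pa U (impF (.box a (impF φ ψ)) (impF (.box a φ) (.box a ψ)))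
  | axT (i : I) (φ : LDEL I A P) : SIG pl pa U (impF (.know i φ) φ)
  | ax4 (i : I) (φ : LDEL I A P) :
      SIG pl pa U (impF (.know i φ) (.know i (.know i φ)))
  | ax5 (i : I) (φ : LDEL I A P) :
      SIG pl pa U (impF (.neg (.know i φ)) (.know i (.neg (.know i φ))))
  | nm (i : I) (a b : A) (φ : LDEL I A P) (B : Set P) (L1 L2 : List P)
      (h1 : ∀ p, p ∈ L1 ↔ p ∈ B) (h2 : ∀ p, p ∈ L2 ↔ p ∉ B) (hab : U.rel i a b) :
      SIG pl pa U (impF (khatF i (diaF b (.conj φ (charF i L1 L2))))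
        (.box a (impF (charF i L1 L2) (khatF i φ))))
  | pr (i : I) (a : A) (φ : LDEL I A P) (L : List A) (hL : ∀ b, b ∈ L ↔ U.rel i a b) :
      SIG pl pa U (impF (diaF a (khatF i φ))
        (bigOr (L.map (fun b => khatF i (diaF b φ)))))
  | det (a : A) (φ : LDEL I A P) : SIG pl pa U (impF (diaF a φ) (.box a φ))
  | exturn (i : I) (LA : I → List A) (hLA : ∀ j a, a ∈ LA j ↔ pl a = j)
      (LI : List I) (hLI : ∀ j, j ∈ LI ↔ j ≠ i) :
      SIG pl pa U (impF (turnF (LA i))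
        (bigAnd (LI.map (fun j => LDEL.neg (turnF (LA j))))))
  | info (a : A) : SIG pl pa U (iffF (diaF a .top) (.atom (pa a) (pl a)))
  | ke (p : P) (i : I) :
      SIG pl pa U (.conj (impF (.atom p i) (.know i (.atom p i)))
        (impF (.neg (.atom p i)) (.know i (.neg (.atom p i)))))
  | mp {φ ψ : LDEL I A P} : SIG pl pa U (impF φ ψ) → SIG pl pa U φ → SIG pl pa U ψ
  | necK (i : I) {φ : LDEL I A P} : SIG pl pa U φ → SIG pl pa U (.know i φ)
  | necB (a : A) {φ : LDEL I A P} : SIG pl pa U φ → SIG pl pa U (.box a φ)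

/-- A set of formulas is SIG-inconsistent if the negation of the conjunction of some
finite list of its members is derivable. -/
def Inconsistent (pl : A → I) (pa : A → P) (U : ObsModel I A)
    (Γ : Set (LDEL I A P)) : Prop :=
  ∃ L : List (LDEL I A P), (∀ φ ∈ L, φ ∈ Γ) ∧ SIG pl pa U (.neg (bigAnd L))

/-- Maximally SIG-consistent sets. -/
def MCS (pl : A → I) (pa : A → P) (U : ObsModel I A) (Γ : Set (LDEL I A P)) : Prop :=
  ¬ Inconsistent pl pa U Γ ∧ ∀ Δ, Γ ⊂ Δ → Inconsistent pl pa U Δ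

/-- Carrier of the canonical model: all maximally consistent sets. -/
abbrev CanW (pl : A → I) (pa : A → P) (U : ObsModel I A) : Type :=
  {Γ : Set (LDEL I A P) // MCS pl pa U Γ}

/-- The canonical model of SIG. -/
def canonical (pl : A → I) (pa : A → P) (U : ObsModel I A) :
    ETLData I A P (CanW pl pa U) where
  sim i w u := ∀ φ, LDEL.know i φ ∈ w.val → φ ∈ u.val
  trans a w u := ∀ φ, LDEL.box a φ ∈ w.val → φ ∈ u.val
  V w i := {p | LDEL.atom p i ∈ w.val}

end Lang

section Completeness
variable {I A P : Type} {pl : A → I} {pa : A → P} {U : ObsModel I A}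

theorem propEval_impF (v : LDEL I A P → Prop) (φ ψ : LDEL I A P) :
    propEval v (impF φ ψ) ↔ (propEval v φ → propEval v ψ) := by
  simp [impF, propEval]

theorem propEval_bigAnd (v : LDEL I A P → Prop) (L : List (LDEL I A P)) :
    propEval v (bigAnd L) ↔ ∀ φ ∈ L, propEval v φ := by
  induction L with
  | nil => simp [bigAnd, propEval]
  | cons φ L ih => simp [bigAnd, propEval, ih]

theorem etlSat_impF {W : Type} (N : ETLData I A P W) (φ ψ : LDEL I A P) (w : W) :
    etlSat N (impF φ ψ) w ↔ (etlSat N φ w → etlSat N ψ w) := by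
  simp [impF, etlSat]

theorem etlSat_diaF {W : Type} (N : ETLData I A P W) (a : A) (φ : LDEL I A P) (w : W) :
    etlSat N (diaF a φ) w ↔ ∃ v, N.trans a w v ∧ etlSat N φ v := by
  simp [diaF, etlSat]

theorem etlSat_khatF {W : Type} (N : ETLData I A P W) (i : I) (φ : LDEL I A P) (w : W) :
    etlSat N (khatF i φ) w ↔ ∃ v, N.sim i w v ∧ etlSat N φ v := by
  simp [khatF, etlSat]

theorem etlSat_bigAnd {W : Type} (N : ETLData I A P W) (L : List (LDEL I A P)) (w : W) :
    etlSat N (bigAnd L) w ↔ ∀ φ ∈ L, etlSat N φ w := by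
  induction L with
  | nil => simp [bigAnd, etlSat]
  | cons φ L ih => simp [bigAnd, etlSat, ih]

theorem etlSat_bigOr {W : Type} (N : ETLData I A P W) (L : List (LDEL I A P)) (w : W) :
    etlSat N (bigOr L) w ↔ ∃ φ ∈ L, etlSat N φ w := by
  induction L with
  | nil => simp [bigOr, etlSat]
  | cons φ L ih => simp [bigOr, orF, etlSat, ih, imp_iff_not_or]

theorem etlSat_charF {W : Type} (N : ETLData I A P W) (i : I) {B : Set P} {L1 L2 : List P}
    (h1 : ∀ p, p ∈ L1 ↔ p ∈ B) (h2 : ∀ p, p ∈ L2 ↔ p ∉ B) (w : W) :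
    etlSat N (charF i L1 L2) w ↔ N.V w i = B := by
  simp only [charF, etlSat, etlSat_bigAnd, List.forall_mem_map, h1, h2, Set.ext_iff]
  exact ⟨fun h p => ⟨fun hp => by_contra fun hB => h.2 p hB hp, h.1 p⟩,
    fun h => ⟨fun p => (h p).2, fun p hB hp => hB ((h p).1 hp)⟩⟩

theorem etlSat_turnF {W : Type} (N : ETLData I A P W) (L : List A) (w : W) :
    etlSat N (turnF L) w ↔ ∃ a ∈ L, ∃ v, N.trans a w v := by
  simp [turnF, etlSat_bigOr, etlSat_diaF, etlSat]

theorem etlSat_of_taut {W : Type} (N : ETLData I A P W) (w : W) {φ : LDEL I A P}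
    (h : ∀ v, propEval v φ) : etlSat N φ w := by
  have key : ∀ ψ : LDEL I A P, propEval (fun χ => etlSat N χ w) ψ ↔ etlSat N ψ w := by
    intro ψ
    induction ψ with
    | neg φ ih => simp [propEval, etlSat, ih]
    | conj φ ψ ih₁ ih₂ => simp [propEval, etlSat, ih₁, ih₂]
    | _ => simp [propEval, etlSat]
  exact (key φ).1 (h _)

/-- Every theorem of SIG holds at every world of every normal epistemic temporal model. -/
theorem SIG.sound {φ : LDEL I A P} (h : SIG pl pa U φ) {W : Type} {N : ETLData I A P W}
    (hE : IsETL N) (hN : Normal pl pa U N) : ∀ w, etlSat N φ w := by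
  obtain ⟨hNm, hPr, hDet, hEx, hInfo, hKe⟩ := hN
  induction h with
  | taut h => exact fun w => etlSat_of_taut N w h
  | distK i φ ψ =>
    simp only [etlSat_impF, etlSat]
    exact fun w h₁ h₂ v hv => h₁ v hv (h₂ v hv)
  | distB a φ ψ =>
    simp only [etlSat_impF, etlSat]
    exact fun w h₁ h₂ v hv => h₁ v hv (h₂ v hv)
  | axT i φ =>
    simp only [etlSat_impF, etlSat]
    exact fun w h => h w ((hE.2 i).refl w)
  | ax4 i φ =>
    simp only [etlSat_impF, etlSat]
    exact fun w h v hv u hu => h u ((hE.2 i).trans hv hu)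
  | ax5 i φ =>
    simp only [etlSat_impF, etlSat]
    exact fun w h v hv h' => h fun u hu => h' u ((hE.2 i).trans ((hE.2 i).symm hv) hu)
  | nm i a b φ B L1 L2 h1 h2 hab =>
    simp only [etlSat_impF, etlSat_khatF, etlSat_diaF, etlSat, etlSat_charF N i h1 h2]
    rintro w ⟨s, hs, t, ht, hφ, hB⟩ u hu huB
    exact ⟨t, hNm i b a w s u t hs ht hu hab (huB.trans hB.symm), hφ⟩
  | pr i a φ L hL =>
    simp only [etlSat_impF, etlSat_bigOr, List.mem_map, exists_exists_and_eq_and,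
      etlSat_khatF, etlSat_diaF]
    rintro w ⟨t, ht, u, hu, hφ⟩
    obtain ⟨s, b, hs, hab, hb⟩ := hPr i a w t u ht hu
    exact ⟨b, (hL b).2 hab, s, hs, u, hb, hφ⟩
  | det a φ =>
    simp only [etlSat_impF, etlSat_diaF, etlSat]
    rintro w ⟨t, ht, hφ⟩ u hu
    exact hDet a w t u ht hu ▸ hφ
  | exturn i LA hLA LI hLI =>
    simp only [etlSat_impF, etlSat_bigAnd, List.forall_mem_map, etlSat_turnF, etlSat, hLA, hLI]
    rintro w ⟨a, ha, ht⟩ j hj ⟨b, hb, hu⟩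
    obtain ⟨k, hk⟩ := hEx w ⟨a, ht⟩
    exact hj (by rw [← ha, ← hb, hk a ht, hk b hu])
  | info a =>
    intro w
    have := hInfo w a
    simp only [iffF, etlSat, etlSat_impF, etlSat_diaF, and_true]
    exact ⟨this.2, this.1⟩
  | ke p i =>
    simp only [etlSat, etlSat_impF]
    exact fun w => ⟨fun h v hv => hKe i w v hv ▸ h, fun h v hv => hKe i w v hv ▸ h⟩
  | mp _ _ ih₁ ih₂ => exact fun w => (etlSat_impF N _ _ w).1 (ih₁ w) (ih₂ w)
  | necK i _ ih => exact fun w v _ => ih v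
  | necB a _ ih => exact fun w v _ => ih v

theorem SIG.of_taut_imp {φ ψ : LDEL I A P} (h : SIG pl pa U φ)
    (ht : ∀ v, propEval v φ → propEval v ψ) : SIG pl pa U ψ :=
  .mp (.taut fun v => (propEval_impF v φ ψ).2 (ht v)) h

theorem SIG.of_taut_imp₂ {φ χ ψ : LDEL I A P} (h : SIG pl pa U φ) (h' : SIG pl pa U χ)
    (ht : ∀ v, propEval v φ → propEval v χ → propEval v ψ) : SIG pl pa U ψ :=
  .mp (h.of_taut_imp fun v hv => (propEval_impF v χ ψ).2 (ht v hv)) h'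

theorem exists_derives_neg_of_inconsistent_union {Γ Δ : Set (LDEL I A P)}
    (h : Inconsistent pl pa U (Γ ∪ Δ)) :
    ∃ L M : List (LDEL I A P), (∀ φ ∈ L, φ ∈ Γ) ∧ (∀ φ ∈ M, φ ∈ Δ) ∧
      SIG pl pa U (impF (bigAnd L) (.neg (bigAnd M))) := by
  classical
  obtain ⟨L, hL, hd⟩ := h
  refine ⟨L.filter (· ∈ Γ), L.filter (· ∈ Δ), by simp, by simp, hd.of_taut_imp fun v hv => ?_⟩
  simp only [propEval, propEval_impF, propEval_bigAnd, List.mem_filter, decide_eq_true_eq]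
    at hv ⊢
  exact fun h₁ h₂ => hv fun φ hφ => (hL φ hφ).elim (fun h => h₁ φ ⟨hφ, h⟩) fun h => h₂ φ ⟨hφ, h⟩

/-- Lindenbaum's lemma for SIG. -/
theorem exists_mcs_of_consistent {Γ : Set (LDEL I A P)} (h : ¬ Inconsistent pl pa U Γ) :
    ∃ w : CanW pl pa U, Γ ⊆ w.val := by
  obtain ⟨Δ, hΓ, hΔ⟩ := zorn_subset_nonempty {Δ | ¬ Inconsistent pl pa U Δ}
    (fun c hcS hc hne => ⟨⋃₀ c, fun ⟨L, hL, hd⟩ => by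
      obtain ⟨s, hs, hLs⟩ := hc.directedOn.exists_mem_subset_of_finite_of_subset_sUnion hne
        L.finite_toSet hL
      exact hcS hs ⟨L, hLs, hd⟩, fun s hs => Set.subset_sUnion_of_mem hs⟩) Γ h
  exact ⟨⟨Δ, hΔ.prop, fun Θ hΘ => by_contra fun hc => hΘ.2 (hΔ.le_of_ge hc hΘ.1)⟩, hΓ⟩

namespace CanW

variable (w : CanW pl pa U)

theorem mem_of_derives {L : List (LDEL I A P)} {φ : LDEL I A P}
    (hL : ∀ ψ ∈ L, ψ ∈ w.val) (h : SIG pl pa U (impF (bigAnd L) φ)) : φ ∈ w.val := by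
  by_contra hφ
  have hi : Inconsistent pl pa U (w.val ∪ {φ}) :=
    w.prop.2 _ ⟨Set.subset_union_left, fun hs => hφ (hs (Or.inr rfl))⟩
  obtain ⟨L', M, hL', hM, hd⟩ := exists_derives_neg_of_inconsistent_union hi
  refine w.prop.1 ⟨L ++ L', by simpa [or_imp, forall_and] using ⟨hL, hL'⟩,
    h.of_taut_imp₂ hd fun v h₁ h₂ => ?_⟩
  simp only [propEval, propEval_impF, propEval_bigAnd, List.mem_append] at h₁ h₂ ⊢
  refine fun h => h₂ (fun ψ hψ => h ψ (Or.inr hψ)) fun ψ hψ => ?_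
  rw [hM ψ hψ]
  exact h₁ fun ψ hψ => h ψ (Or.inl hψ)

theorem mem_of_sig {φ : LDEL I A P} (h : SIG pl pa U φ) : φ ∈ w.val :=
  w.mem_of_derives (L := []) (by simp)
    (h.of_taut_imp fun v hv => (propEval_impF v _ _).2 fun _ => hv)

theorem mem_mp {φ ψ : LDEL I A P} (h : SIG pl pa U (impF φ ψ)) (hφ : φ ∈ w.val) : ψ ∈ w.val :=
  w.mem_of_derives (L := [φ]) (by simpa using hφ) (h.of_taut_imp fun v hv => by
    simpa [propEval_impF, propEval_bigAnd] using hv)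

theorem mem_neg {φ : LDEL I A P} : LDEL.neg φ ∈ w.val ↔ φ ∉ w.val := by
  refine ⟨fun h h' => w.prop.1 ⟨[φ, .neg φ], by simp [h, h'], .taut fun v => ?_⟩, fun h => ?_⟩
  · simp [propEval, bigAnd]
  · have hi : Inconsistent pl pa U (w.val ∪ {φ}) :=
      w.prop.2 _ ⟨Set.subset_union_left, fun hs => h (hs (Or.inr rfl))⟩
    obtain ⟨L, M, hL, hM, hd⟩ := exists_derives_neg_of_inconsistent_union hi
    refine w.mem_of_derives hL (hd.of_taut_imp fun v hv => ?_)
    simp only [propEval, propEval_impF, propEval_bigAnd] at hv ⊢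
    exact fun h₁ h₂ => hv h₁ fun ψ hψ => by rw [hM ψ hψ]; exact h₂

theorem mem_top : LDEL.top ∈ w.val := w.mem_of_sig (.taut fun _ => trivial)

theorem mem_conj {φ ψ : LDEL I A P} : LDEL.conj φ ψ ∈ w.val ↔ φ ∈ w.val ∧ ψ ∈ w.val := by
  refine ⟨fun h => ⟨w.mem_mp (.taut fun v => ?_) h, w.mem_mp (.taut fun v => ?_) h⟩,
    fun h => w.mem_of_derives (L := [φ, ψ]) (by simp [h]) (.taut fun v => ?_)⟩
  all_goals simp +contextual [propEval_impF, propEval, bigAnd]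

theorem mem_impF {φ ψ : LDEL I A P} : impF φ ψ ∈ w.val ↔ (φ ∈ w.val → ψ ∈ w.val) := by
  simp [impF, mem_neg, mem_conj]

theorem mem_bigAnd {L : List (LDEL I A P)} : bigAnd L ∈ w.val ↔ ∀ φ ∈ L, φ ∈ w.val := by
  induction L with
  | nil => simp [bigAnd, mem_top]
  | cons φ L ih => simp [bigAnd, mem_conj, ih]

theorem mem_bigOr {L : List (LDEL I A P)} : bigOr L ∈ w.val ↔ ∃ φ ∈ L, φ ∈ w.val := by
  induction L with
  | nil => simp [bigOr, mem_neg, mem_top]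
  | cons φ L ih => simp [bigOr, orF, mem_conj, mem_neg, ih, imp_iff_not_or]

theorem mem_charF {i : I} {L1 L2 : List P}
    (h1 : ∀ p, p ∈ L1 ↔ LDEL.atom p i ∈ w.val) (h2 : ∀ p, p ∈ L2 ↔ LDEL.atom p i ∉ w.val) :
    charF i L1 L2 ∈ w.val := by
  simp [charF, mem_conj, mem_bigAnd, mem_neg, h1, h2]

end CanW

/-- An operator on formulas satisfying distribution and necessitation. -/
structure IsNormalOp (pl : A → I) (pa : A → P) (U : ObsModel I A)
    (m : LDEL I A P → LDEL I A P) : Prop where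
  dist : ∀ φ ψ, SIG pl pa U (impF (m (impF φ ψ)) (impF (m φ) (m ψ)))
  nec : ∀ φ, SIG pl pa U φ → SIG pl pa U (m φ)

theorem isNormalOp_know (i : I) : IsNormalOp pl pa U (LDEL.know i) :=
  ⟨.distK i, fun _ => .necK i⟩

theorem isNormalOp_box (a : A) : IsNormalOp pl pa U (LDEL.box a) :=
  ⟨.distB a, fun _ => .necB a⟩

namespace IsNormalOp

variable {m : LDEL I A P → LDEL I A P}

theorem mono (hm : IsNormalOp pl pa U m) {φ ψ : LDEL I A P} (h : SIG pl pa U (impF φ ψ)) :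
    SIG pl pa U (impF (m φ) (m ψ)) :=
  .mp (hm.dist φ ψ) (hm.nec _ h)

theorem mem_mono (hm : IsNormalOp pl pa U m) (w : CanW pl pa U) {φ ψ : LDEL I A P}
    (h : SIG pl pa U (impF φ ψ)) (hφ : m φ ∈ w.val) : m ψ ∈ w.val :=
  w.mem_mp (hm.mono h) hφ

theorem mem_bigAnd (hm : IsNormalOp pl pa U m) (w : CanW pl pa U) {L : List (LDEL I A P)}
    (h : ∀ φ ∈ L, m φ ∈ w.val) : m (bigAnd L) ∈ w.val := by
  induction L with
  | nil => exact w.mem_of_sig (hm.nec _ (.taut fun _ => trivial))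
  | cons φ L ih =>
    simp only [List.forall_mem_cons] at h
    have h₁ : m (impF (bigAnd L) (bigAnd (φ :: L))) ∈ w.val :=
      hm.mem_mono w (.taut fun v => by simp +contextual [propEval_impF, propEval, bigAnd]) h.1
    exact w.mem_impF.1 (w.mem_mp (hm.dist _ _) h₁) (ih h.2)

/-- If `m` rules out no finite part of `X` at `w`, some `m`-successor of `w` includes `X`. -/
theorem exists_successor_superset (hm : IsNormalOp pl pa U m) (w : CanW pl pa U)
    {X : Set (LDEL I A P)}
    (hX : ∀ M : List (LDEL I A P), (∀ φ ∈ M, φ ∈ X) → m (.neg (bigAnd M)) ∉ w.val) :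
    ∃ u : CanW pl pa U, (∀ φ, m φ ∈ w.val → φ ∈ u.val) ∧ X ⊆ u.val := by
  have hc : ¬ Inconsistent pl pa U ({φ | m φ ∈ w.val} ∪ X) := by
    intro hi
    obtain ⟨L, M, hL, hM, hd⟩ := exists_derives_neg_of_inconsistent_union hi
    exact hX M hM (hm.mem_mono w hd (hm.mem_bigAnd w hL))
  obtain ⟨u, hu⟩ := exists_mcs_of_consistent hc
  exact ⟨u, fun φ hφ => hu (Or.inl hφ), fun φ hφ => hu (Or.inr hφ)⟩

theorem exists_successor_notMem (hm : IsNormalOp pl pa U m) (w : CanW pl pa U) {φ : LDEL I A P}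
    (h : m φ ∉ w.val) :
    ∃ u : CanW pl pa U, (∀ ψ, m ψ ∈ w.val → ψ ∈ u.val) ∧ φ ∉ u.val := by
  obtain ⟨u, hu, hφ⟩ := hm.exists_successor_superset w (X := {.neg φ}) fun M hM hn =>
    h (hm.mem_mono w (.taut fun v => by
      simp only [propEval_impF, propEval, propEval_bigAnd]
      refine fun hv => by_contra fun hφ => hv fun ψ hψ => ?_
      rw [hM ψ hψ]
      exact hφ) hn)
  exact ⟨u, hu, u.mem_neg.1 (hφ rfl)⟩

theorem neg_neg_mem_iff (hm : IsNormalOp pl pa U m) (w : CanW pl pa U) {φ : LDEL I A P} :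
    m (.neg (.neg φ)) ∈ w.val ↔ m φ ∈ w.val :=
  ⟨hm.mem_mono w (.taut fun v => by simp [propEval_impF, propEval]),
    hm.mem_mono w (.taut fun v => by simp [propEval_impF, propEval])⟩

end IsNormalOp

/-- Truth lemma for the canonical model. -/
theorem etlSat_canonical_iff (φ : LDEL I A P) (w : CanW pl pa U) :
    etlSat (canonical pl pa U) φ w ↔ φ ∈ w.val := by
  induction φ generalizing w with
  | top => simp [etlSat, w.mem_top]
  | atom p i => rfl
  | neg φ ih => simp [etlSat, ih, w.mem_neg]
  | conj φ ψ ih₁ ih₂ => simp [etlSat, ih₁, ih₂, w.mem_conj]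
  | know i φ ih =>
    simp only [etlSat, ih]
    refine ⟨fun h => by_contra fun hn => ?_, fun h v hv => hv φ h⟩
    obtain ⟨u, hu, hφ⟩ := (isNormalOp_know i).exists_successor_notMem w hn
    exact hφ (h u hu)
  | box a φ ih =>
    simp only [etlSat, ih]
    refine ⟨fun h => by_contra fun hn => ?_, fun h v hv => hv φ h⟩
    obtain ⟨u, hu, hφ⟩ := (isNormalOp_box a).exists_successor_notMem w hn
    exact hφ (h u hu)

theorem khatF_mem_of_sim {i : I} {w u : CanW pl pa U} (h : (canonical pl pa U).sim i w u)
    {φ : LDEL I A P} (hφ : φ ∈ u.val) : khatF i φ ∈ w.val :=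
  w.mem_neg.2 fun hn => u.mem_neg.1 (h _ hn) hφ

theorem diaF_mem_of_trans {a : A} {w u : CanW pl pa U} (h : (canonical pl pa U).trans a w u)
    {φ : LDEL I A P} (hφ : φ ∈ u.val) : diaF a φ ∈ w.val :=
  w.mem_neg.2 fun hn => u.mem_neg.1 (h _ hn) hφ

theorem diaF_top_mem_iff {a : A} {w : CanW pl pa U} :
    diaF a .top ∈ w.val ↔ ∃ u, (canonical pl pa U).trans a w u := by
  rw [← etlSat_canonical_iff, etlSat_diaF]
  simp [etlSat]

theorem canonical_sim_equivalence (i : I) : Equivalence ((canonical pl pa U).sim i) where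
  refl w _ hφ := w.mem_mp (.axT i _) hφ
  symm {w u} h φ hφ := by
    by_contra hn
    have hK : LDEL.know i φ ∉ w.val := fun hK => hn (w.mem_mp (.axT i φ) hK)
    exact u.mem_neg.1 (h _ (w.mem_mp (.ax5 i φ) (w.mem_neg.2 hK))) hφ
  trans {w _ _} h₁ h₂ φ hφ := h₂ _ (h₁ _ (w.mem_mp (.ax4 i φ) hφ))

theorem canonical_V_eq_of_sim {i : I} {w u : CanW pl pa U}
    (h : (canonical pl pa U).sim i w u) :
    (canonical pl pa U).V w i = (canonical pl pa U).V u i := by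
  ext p
  have hk := w.mem_conj.1 (w.mem_of_sig (.ke p i))
  exact ⟨fun hp => h _ (w.mem_impF.1 hk.1 hp), fun hp => by_contra fun hn =>
    u.mem_neg.1 (h _ (w.mem_impF.1 hk.2 (w.mem_neg.2 hn))) hp⟩

theorem canonical_det {a : A} {s t t' : CanW pl pa U} (h : (canonical pl pa U).trans a s t)
    (h' : (canonical pl pa U).trans a s t') : t = t' := by
  have key : ∀ {t t' : CanW pl pa U}, (canonical pl pa U).trans a s t →
      (canonical pl pa U).trans a s t' → t.val ⊆ t'.val :=
    fun h h' φ hφ => h' _ (s.mem_mp (.det a φ) (diaF_mem_of_trans h hφ))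
  exact Subtype.ext (Set.Subset.antisymm (key h h') (key h' h))

theorem canonical_info (s : CanW pl pa U) (a : A) :
    pa a ∈ (canonical pl pa U).V s (pl a) ↔ ∃ t, (canonical pl pa U).trans a s t := by
  have hk := s.mem_conj.1 (s.mem_of_sig (.info a))
  rw [← diaF_top_mem_iff]
  exact ⟨s.mem_impF.1 hk.2, s.mem_impF.1 hk.1⟩

theorem exists_list_mem_iff {α : Type*} [Finite α] (p : α → Prop) :
    ∃ L : List α, ∀ x, x ∈ L ↔ p x :=
  ⟨(Set.toFinite {x | p x}).toFinset.toList, by simp⟩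

theorem canonical_no_miracles [Finite P] {i : I} {a b : A} {s s' t t' : CanW pl pa U}
    (hs : (canonical pl pa U).sim i s s') (ha : (canonical pl pa U).trans a s' t')
    (hb : (canonical pl pa U).trans b s t) (hU : U.rel i b a)
    (hV : (canonical pl pa U).V t i = (canonical pl pa U).V t' i) :
    (canonical pl pa U).sim i t t' := by
  intro φ hφ
  by_contra hn
  obtain ⟨L1, h1⟩ := exists_list_mem_iff (fun p => p ∈ (canonical pl pa U).V t i)
  obtain ⟨L2, h2⟩ := exists_list_mem_iff (fun p => p ∉ (canonical pl pa U).V t i)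
  have ht : charF i L1 L2 ∈ t.val := t.mem_charF h1 h2
  have ht' : charF i L1 L2 ∈ t'.val := by
    rw [hV] at h1 h2
    exact t'.mem_charF h1 h2
  have hk := khatF_mem_of_sim hs
    (diaF_mem_of_trans ha (t'.mem_conj.2 ⟨t'.mem_neg.2 hn, ht'⟩))
  have hbox := hb _ (s.mem_mp (.nm i b a (.neg φ) _ L1 L2 h1 h2 hU) hk)
  exact t.mem_neg.1 (t.mem_impF.1 hbox ht) (((isNormalOp_know i).neg_neg_mem_iff t).2 hφ)

theorem diaF_imp {a : A} {φ ψ : LDEL I A P} (h : SIG pl pa U (impF φ ψ)) :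
    SIG pl pa U (impF (diaF a φ) (diaF a ψ)) :=
  ((isNormalOp_box a).mono (h.of_taut_imp (ψ := impF (.neg ψ) (.neg φ)) fun v hv => by
    simp only [propEval_impF, propEval] at hv ⊢
    exact mt hv)).of_taut_imp fun v hv => by
      simp only [diaF, propEval_impF] at hv ⊢
      exact mt hv

theorem khatF_imp {i : I} {φ ψ : LDEL I A P} (h : SIG pl pa U (impF φ ψ)) :
    SIG pl pa U (impF (khatF i φ) (khatF i ψ)) :=
  ((isNormalOp_know i).mono (h.of_taut_imp (ψ := impF (.neg ψ) (.neg φ)) fun v hv => by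
    simp only [propEval_impF, propEval] at hv ⊢
    exact mt hv)).of_taut_imp fun v hv => by
      simp only [khatF, propEval_impF] at hv ⊢
      exact mt hv

theorem bigAnd_imp {L : List (LDEL I A P)} {φ : LDEL I A P} (h : φ ∈ L) :
    SIG pl pa U (impF (bigAnd L) φ) :=
  .taut fun v => by
    simp only [propEval_impF, propEval_bigAnd]
    exact fun hv => hv φ h

/-- A single action witnesses the perfect-recall disjunction uniformly in the formula. -/
theorem exists_action_forall_khatF_diaF_mem [Finite A] {i : I} {a : A} {s t t' : CanW pl pa U}
    (ha : (canonical pl pa U).trans a s t) (hi : (canonical pl pa U).sim i t t') :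
    ∃ b, U.rel i a b ∧ ∀ φ ∈ t'.val, khatF i (diaF b φ) ∈ s.val := by
  by_contra! hcon
  have hcon' : ∀ b, ∃ φ ∈ t'.val, U.rel i a b → khatF i (diaF b φ) ∉ s.val := fun b => by
    by_cases hb : U.rel i a b
    · obtain ⟨φ, hφ, hn⟩ := hcon b hb
      exact ⟨φ, hφ, fun _ => hn⟩
    · exact ⟨.top, t'.mem_top, fun h => absurd h hb⟩
  choose f hf hn using hcon'
  obtain ⟨L, hL⟩ := exists_list_mem_iff (U.rel i a)
  have hmem : bigAnd (L.map f) ∈ t'.val := t'.mem_bigAnd.2 (by simp [hf])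
  have hor := s.mem_mp (.pr i a _ L hL) (diaF_mem_of_trans ha (khatF_mem_of_sim hi hmem))
  simp only [CanW.mem_bigOr, List.mem_map, exists_exists_and_eq_and] at hor
  obtain ⟨b, hb, hbs⟩ := hor
  exact hn b ((hL b).1 hb)
    (s.mem_mp (khatF_imp (diaF_imp (bigAnd_imp (List.mem_map_of_mem hb)))) hbs)

theorem canonical_perfect_recall [Finite A] {i : I} {a : A} {s t t' : CanW pl pa U}
    (ha : (canonical pl pa U).trans a s t) (hi : (canonical pl pa U).sim i t t') :
    ∃ s' b, (canonical pl pa U).sim i s s' ∧ U.rel i a b ∧ (canonical pl pa U).trans b s' t' := by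
  obtain ⟨b, hb, hk⟩ := exists_action_forall_khatF_diaF_mem ha hi
  obtain ⟨s', hs', hX⟩ := (isNormalOp_know i).exists_successor_superset s
    (X := {ψ | ∃ φ ∈ t'.val, diaF b φ = ψ}) fun M hM hn => by
      have hM' : M ∈ Set.range (List.map fun x : t'.val => diaF b x.val) := by
        rw [Set.range_list_map]
        exact fun φ hφ => by simpa using hM φ hφ
      obtain ⟨L, rfl⟩ := hM'
      have hL : bigAnd (L.map Subtype.val) ∈ t'.val := t'.mem_bigAnd.2 (by simp +contextual)
      obtain ⟨u, hu, hd⟩ := (isNormalOp_know i).exists_successor_notMem s (s.mem_neg.1 (hk _ hL))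
      rw [u.mem_neg, not_not] at hd
      refine u.mem_neg.1 (hu _ hn) (u.mem_bigAnd.2 fun φ hφ => ?_)
      obtain ⟨x, hx, rfl⟩ := List.mem_map.1 hφ
      exact u.mem_mp (diaF_imp (bigAnd_imp (List.mem_map_of_mem hx))) hd
  refine ⟨s', b, hs', hb, fun φ hφ => by_contra fun hn => ?_⟩
  have hd : diaF b (.neg φ) ∈ s'.val := hX ⟨_, t'.mem_neg.2 hn, rfl⟩
  exact s'.mem_neg.1 hd (((isNormalOp_box b).neg_neg_mem_iff s').2 hφ)

theorem canonical_exturn [Finite I] [Finite A] {s : CanW pl pa U} {a b : A}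
    (ha : a ∈ Act (canonical pl pa U) s) (hb : b ∈ Act (canonical pl pa U) s) :
    pl b = pl a := by
  by_contra hne
  choose LA hLA using fun j : I => exists_list_mem_iff (fun c : A => pl c = j)
  obtain ⟨LI, hLI⟩ := exists_list_mem_iff (fun j : I => j ≠ pl a)
  have hturn : ∀ c ∈ Act (canonical pl pa U) s, turnF (LA (pl c)) ∈ s.val := fun c hc =>
    s.mem_bigOr.2 ⟨_, List.mem_map_of_mem ((hLA _ c).2 rfl), diaF_top_mem_iff.2 hc⟩
  have hand := s.mem_bigAnd.1 (s.mem_mp (.exturn (pl a) LA hLA LI hLI) (hturn a ha))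
  exact s.mem_neg.1 (hand _ (List.mem_map_of_mem ((hLI (pl b)).2 hne))) (hturn b hb)

theorem canonical_normal [Finite I] [Finite A] [Finite P] :
    Normal pl pa U (canonical pl pa U) :=
  ⟨fun _ _ _ _ _ _ _ => canonical_no_miracles, fun _ _ _ _ _ => canonical_perfect_recall,
    fun _ _ _ _ => canonical_det, fun _ ⟨a, ha⟩ => ⟨pl a, fun _ hb => canonical_exturn ha hb⟩,
    canonical_info, fun _ _ _ => canonical_V_eq_of_sim⟩

theorem exists_notMem_of_not_sig {φ : LDEL I A P} (h : ¬ SIG pl pa U φ) :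
    ∃ w : CanW pl pa U, φ ∉ w.val := by
  have hc : ¬ Inconsistent pl pa U {LDEL.neg φ} := fun ⟨L, hL, hd⟩ =>
    h (hd.of_taut_imp fun v hv => by
      simp only [propEval, propEval_bigAnd] at hv
      refine by_contra fun hφ => hv fun ψ hψ => ?_
      rw [hL ψ hψ]
      exact hφ)
  obtain ⟨w, hw⟩ := exists_mcs_of_consistent hc
  exact ⟨w, w.mem_neg.1 (hw rfl)⟩

end Completeness

section Statements
variable {I A P S W W' : Type}

theorem statement18 [Fintype I] [Fintype A] [Fintype P] [Nonempty I] [Nonempty A]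
    (pl : A → I) (pa : A → P) (U : ObsModel I A) (φ : LDEL I A P) :
    SIG pl pa U φ ↔
      ∀ (W : Type) (N : ETLData I A P W), IsETL N → Normal pl pa U N →
        ∀ w : W, etlSat N φ w := by
  refine ⟨fun h W N hE hN => h.sound hE hN, fun h => by_contra fun hn => ?_⟩
  obtain ⟨w, hw⟩ := exists_notMem_of_not_sig hn
  exact hw ((etlSat_canonical_iff φ w).1
    (h _ _ ⟨⟨w⟩, canonical_sim_equivalence⟩ canonical_normal w))

end Statements
end GameRuns
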